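/- Let k > j ≥ 0 be integers, let w be the unique infinite word beginning with a that is a fixed point of the substitution a ↦ a^{k−j} b aʲ, b ↦ a, and for n ≥ 1 let p_n be the position of the n-th occurrence of a in w and q_n the position of the n-th occurrence of b in w (positions 1-indexed). Then q_n = p_n + k·n − j for all n ≥ 1, and the sets {p_n : n ≥ 1} and {q_n : n ≥ 1} are complementary: every positive integer occurs exactly once among the p_n and q_n. -/

import Mathlib

inductive AB : Type | A | B
  deriving DecidableEq

/-- The substitution `a ↦ a^{k−j} b aʲ`, `b ↦ a`. -/
def σ (k j : ℕ) : AB → List AB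
  | .A => List.replicate (k - j) AB.A ++ [AB.B] ++ List.replicate j AB.A
  | .B => [AB.A]

/-- The `n`-th iterate `σⁿ(a)`. -/
def σIter (k j n : ℕ) : List AB := (fun l => l.flatMap (σ k j))^[n] [AB.A]

/-- The unique infinite word (0-indexed) beginning with `a` that is a fixed point of
`σ` (for `k > j ≥ 0`); since then `σⁿ⁺¹(a)` has length greater than `n` and each
`σⁿ(a)` is a prefix of `σⁿ⁺¹(a)`, its `n`-th letter is the `n`-th letter of
`σⁿ⁺¹(a)`. -/
def w (k j n : ℕ) : AB := (σIter k j (n + 1)).getD n AB.A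

/-- The position (1-indexed) of the `n`-th occurrence (`n ≥ 1`) of the letter `x`
in the infinite word `w k j` (with letters at 0-indexed places). -/
noncomputable def occ (k j : ℕ) (x : AB) (n : ℕ) : ℕ :=
  Nat.nth (fun i => w k j i = x) (n - 1) + 1

theorem σIter_succ (k j n : ℕ) : σIter k j (n + 1) = (σIter k j n).flatMap (σ k j) := by
  simp only [σIter, Function.iterate_succ_apply']

theorem List.IsPrefix.flatMap_right {α β : Type*} {l₁ l₂ : List α} (h : l₁ <+: l₂)
    (f : α → List β) : l₁.flatMap f <+: l₂.flatMap f := by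
  obtain ⟨t, rfl⟩ := h
  exact ⟨t.flatMap f, by simp⟩

theorem singleton_prefix_σ {k j : ℕ} (hkj : j < k) : [AB.A] <+: σ k j AB.A := by
  obtain ⟨d, hd⟩ : ∃ d, k - j = d + 1 := ⟨k - j - 1, by omega⟩
  exact ⟨_, by rw [σ, hd, List.replicate_succ]; rfl⟩

theorem σIter_prefix_succ {k j : ℕ} (hkj : j < k) (n : ℕ) :
    σIter k j n <+: σIter k j (n + 1) := by
  induction n with
  | zero => simpa [σIter] using singleton_prefix_σ hkj
  | succ n ih =>
    rw [σIter_succ k j n, σIter_succ k j (n + 1)]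
    exact ih.flatMap_right _

theorem σIter_prefix_of_le {k j : ℕ} (hkj : j < k) {m n : ℕ} (h : m ≤ n) :
    σIter k j m <+: σIter k j n := by
  induction n, h using Nat.le_induction with
  | base => exact List.prefix_rfl
  | succ n _ ih => exact ih.trans (σIter_prefix_succ hkj n)

theorem length_le_length_flatMap_σ (k j : ℕ) (l : List AB) :
    l.length ≤ (l.flatMap (σ k j)).length := by
  induction l with
  | nil => simp
  | cons x l ih =>
    cases x <;> simp only [List.flatMap_cons, σ, List.length_append, List.length_cons,
      List.length_replicate, List.length_nil] <;> omega

theorem lt_length_σIter {k j : ℕ} (hkj : j < k) (n : ℕ) : n < (σIter k j n).length := by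
  induction n with
  | zero => simp [σIter]
  | succ n ih =>
    obtain ⟨t, ht⟩ : [AB.A] <+: σIter k j n := σIter_prefix_of_le hkj (Nat.zero_le n)
    have hlen := length_le_length_flatMap_σ k j t
    rw [σIter_succ, ← ht]
    rw [← ht] at ih
    simp only [List.flatMap_append, List.flatMap_cons, List.flatMap_nil, σ, List.length_append,
      List.length_cons, List.length_replicate, List.length_nil] at ih ⊢
    omega

/-- The prefix of length `m` of the infinite word `w k j`. -/
def wPrefix (k j m : ℕ) : List AB := (List.range m).map (w k j)

theorem length_wPrefix (k j m : ℕ) : (wPrefix k j m).length = m := by simp [wPrefix]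

theorem wPrefix_succ (k j m : ℕ) : wPrefix k j (m + 1) = wPrefix k j m ++ [w k j m] := by
  simp [wPrefix, List.range_succ]

theorem count_wPrefix (k j : ℕ) (x : AB) (m : ℕ) :
    (wPrefix k j m).count x = Nat.count (fun i => w k j i = x) m := by
  induction m with
  | zero => simp [wPrefix]
  | succ m ih => simp [wPrefix_succ, Nat.count_succ, ih, List.count_singleton]

theorem w_eq_getElem_σIter {k j : ℕ} (hkj : j < k) {n i : ℕ} (h : i < (σIter k j n).length) :
    w k j i = (σIter k j n)[i] := by
  have hi : i < (σIter k j (i + 1)).length := (Nat.lt_succ_self i).trans (lt_length_σIter hkj _)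
  rw [w, List.getD_eq_getElem _ _ hi]
  rcases le_total (i + 1) n with hn | hn
  · exact (σIter_prefix_of_le hkj hn).getElem hi
  · exact ((σIter_prefix_of_le hkj hn).getElem h).symm

theorem eq_wPrefix_of_prefix_σIter {k j : ℕ} (hkj : j < k) {n : ℕ} {l : List AB}
    (h : l <+: σIter k j n) : l = wPrefix k j l.length := by
  refine List.ext_getElem (length_wPrefix k j _).symm fun i hi _ => ?_
  simp only [wPrefix, List.getElem_map, List.getElem_range]
  rw [w_eq_getElem_σIter hkj (hi.trans_le h.length_le)]
  exact h.getElem hi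

theorem wPrefix_prefix_σIter {k j : ℕ} (hkj : j < k) (m : ℕ) :
    wPrefix k j m <+: σIter k j m := by
  have h := eq_wPrefix_of_prefix_σIter hkj (List.take_prefix m (σIter k j m))
  rw [List.length_take, min_eq_left (lt_length_σIter hkj m).le] at h
  exact h ▸ List.take_prefix m _

/-- The infinite word is fixed by the substitution. -/
theorem flatMap_σ_wPrefix {k j : ℕ} (hkj : j < k) (m : ℕ) :
    (wPrefix k j m).flatMap (σ k j) = wPrefix k j ((wPrefix k j m).flatMap (σ k j)).length := by
  refine eq_wPrefix_of_prefix_σIter hkj (n := m + 1) ?_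
  rw [σIter_succ]
  exact (wPrefix_prefix_σIter hkj m).flatMap_right _

theorem length_flatMap_σ {k j : ℕ} (hkj : j < k) (l : List AB) :
    (l.flatMap (σ k j)).length = l.length + k * l.count AB.A := by
  induction l with
  | nil => simp
  | cons x l ih =>
    cases x
    · simp only [List.flatMap_cons, σ, List.length_append, List.length_cons,
        List.length_replicate, List.length_nil, List.count_cons_self, ih, mul_add]
      omega
    · simp only [List.flatMap_cons, σ, List.length_append, List.length_cons, List.length_nil, ih,
        List.count_cons_of_ne (by decide : AB.B ≠ AB.A)]
      omega

theorem count_B_flatMap_σ (k j : ℕ) (l : List AB) :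
    (l.flatMap (σ k j)).count AB.B = l.count AB.A := by
  induction l with
  | nil => simp
  | cons x l ih => cases x <;> simp [σ, ih, List.count_replicate, add_comm]

theorem length_le_count_A_flatMap_σ {k j : ℕ} (hkj : j < k) (l : List AB) :
    l.length ≤ (l.flatMap (σ k j)).count AB.A := by
  induction l with
  | nil => simp
  | cons x l ih =>
    cases x <;> simp [σ] <;> omega

theorem Nat.infinite_setOf_of_le_count {p : ℕ → Prop} [DecidablePred p]
    (h : ∀ m, ∃ N, m ≤ Nat.count p N) : {i | p i}.Infinite := by
  intro hf
  obtain ⟨N, hN⟩ := h (hf.toFinset.card + 1)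
  have : Nat.count p N ≤ hf.toFinset.card := by
    rw [Nat.count_eq_card_filter_range]
    exact Finset.card_le_card fun i hi => hf.mem_toFinset.mpr (Finset.mem_filter.mp hi).2
  omega

theorem infinite_setOf_w_eq_A {k j : ℕ} (hkj : j < k) : {i | w k j i = AB.A}.Infinite := by
  refine Nat.infinite_setOf_of_le_count fun m => ⟨((wPrefix k j m).flatMap (σ k j)).length, ?_⟩
  rw [← count_wPrefix, ← flatMap_σ_wPrefix hkj]
  simpa [length_wPrefix] using length_le_count_A_flatMap_σ hkj (wPrefix k j m)

theorem infinite_setOf_w_eq_B {k j : ℕ} (hkj : j < k) : {i | w k j i = AB.B}.Infinite := by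
  refine Nat.infinite_setOf_of_le_count fun m =>
    ⟨((wPrefix k j (Nat.nth (fun i => w k j i = AB.A) m)).flatMap (σ k j)).length, ?_⟩
  rw [← count_wPrefix, ← flatMap_σ_wPrefix hkj, count_B_flatMap_σ, count_wPrefix,
    Nat.count_nth_of_infinite (infinite_setOf_w_eq_A hkj)]

theorem infinite_setOf_w_eq {k j : ℕ} (hkj : j < k) (x : AB) : {i | w k j i = x}.Infinite := by
  cases x
  exacts [infinite_setOf_w_eq_A hkj, infinite_setOf_w_eq_B hkj]

/-- The `b` in the image of the `n`-th `a` (`n` counted from `0`) is the `n`-th `b`. -/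
theorem nth_w_eq_B {k j : ℕ} (hkj : j < k) (n : ℕ) :
    Nat.nth (fun i => w k j i = AB.B) n =
      Nat.nth (fun i => w k j i = AB.A) n + k * n + (k - j) := by
  set p := Nat.nth (fun i => w k j i = AB.A) n with hp
  have hwp : w k j p = AB.A := Nat.nth_mem_of_infinite (infinite_setOf_w_eq_A hkj) n
  have hcount : (wPrefix k j p).count AB.A = n := by
    rw [count_wPrefix, hp, Nat.count_nth_of_infinite (infinite_setOf_w_eq_A hkj)]
  set u := (wPrefix k j p).flatMap (σ k j) ++ List.replicate (k - j) AB.A with hu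
  have hlen : u.length = p + k * n + (k - j) := by
    rw [hu, List.length_append, length_flatMap_σ hkj, length_wPrefix, hcount,
      List.length_replicate]
  have hpre : u ++ [AB.B] <+: σIter k j (p + 1 + 1) := by
    rw [σIter_succ]
    refine List.IsPrefix.trans ?_ ((wPrefix_prefix_σIter hkj (p + 1)).flatMap_right _)
    exact ⟨List.replicate j AB.A, by simp [hu, wPrefix_succ, hwp, σ]⟩
  have hub := eq_wPrefix_of_prefix_σIter hkj hpre
  rw [List.length_append, List.length_singleton, wPrefix_succ] at hub
  obtain ⟨hu', hb⟩ := List.append_inj' hub rfl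
  have hwB : w k j u.length = AB.B := (List.singleton_inj.mp hb).symm
  have hcB : Nat.count (fun i => w k j i = AB.B) u.length = n := by
    rw [← count_wPrefix, ← hu', hu, List.count_append, count_B_flatMap_σ, hcount,
      List.count_replicate]
    simp
  rw [← hlen, ← Nat.nth_count (p := fun i => w k j i = AB.B) hwB, hcB]

/-- Let `k > j ≥ 0` and let `pₙ`, `qₙ` be the positions of the `n`-th `a`, resp. `b`,
in the fixed point of `a ↦ a^{k−j} b aʲ`, `b ↦ a`.  Then `qₙ = pₙ + kn − j` for all
`n ≥ 1`, and every positive integer occurs exactly once among the `pₙ` and `qₙ`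
(`n ≥ 1`): the sets `{pₙ}` and `{qₙ}` are complementary. -/
theorem occ_eq_and_complementary (k j : ℕ) (hkj : j < k) :
    (∀ n : ℕ, 1 ≤ n → (occ k j AB.B n : ℤ) = occ k j AB.A n + k * n - j) ∧
    (∀ m : ℕ, 1 ≤ m →
      ∃! x : ℕ × AB, 1 ≤ x.1 ∧ m = occ k j x.2 x.1) := by
  refine ⟨fun n hn => ?_, fun m hm => ?_⟩
  · obtain ⟨n, rfl⟩ := Nat.exists_eq_add_of_le' hn
    simp only [occ, Nat.add_sub_cancel, nth_w_eq_B hkj n]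
    push_cast [Nat.cast_sub hkj.le]
    ring
  · obtain ⟨m, rfl⟩ := Nat.exists_eq_add_of_le' hm
    refine ⟨(Nat.count (fun i => w k j i = w k j m) m + 1, w k j m), ⟨by simp, ?_⟩, ?_⟩
    · simp only [occ, Nat.add_sub_cancel]
      rw [Nat.nth_count (p := fun i => w k j i = w k j m) rfl]
    · rintro ⟨n, x⟩ ⟨hn, hx⟩
      obtain ⟨n, rfl⟩ := Nat.exists_eq_add_of_le' hn
      simp only [occ, Nat.add_sub_cancel, Nat.add_right_cancel_iff] at hx
      have hinf := infinite_setOf_w_eq hkj x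
      have hwx : w k j m = x := by
        rw [hx]
        exact Nat.nth_mem_of_infinite hinf n
      rw [hwx, hx, Nat.count_nth_of_infinite hinf]
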